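/- (Lemma 6(ii), two tangentially intersecting conics.) Let P_1, P_2 ∈ K[X_0, X_1, X_2] be homogeneous of degree 2 defining nonsingular conics D_1 and D_2 in P^2(K) that intersect tangentially in exactly one point: there is a nonzero p ∈ K^3 with P_1(p) = P_2(p) = 0, every common zero of P_1 and P_2 in K^3 \ {0} is a scalar multiple of p, and the gradient vectors of P_1 and P_2 at p are proportional (the two conics have the same tangent line at p). Then there exists a non-constant analytic map from K to P^2(K) omitting both D_1 and D_2; i.e., P^2(K) \ (D_1 ∪ D_2) is not K-hyperbolic. -/

import Mathlib

open MvPolynomial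

/-- A quadratic form is a combination of products of two variables. -/
theorem MvPolynomial.IsHomogeneous.exists_eq_sum_C_mul_X_mul_X {σ R : Type*} [Fintype σ]
    [CommSemiring R] {P : MvPolynomial σ R} (hP : P.IsHomogeneous 2) :
    ∃ c : σ → σ → R, P = ∑ i, ∑ j, C (c i j) * (X i * X j) := by
  classical
  rw [← P.support_sum_monomial_coeff]
  refine Finset.sum_induction _
    (fun Q => ∃ c : σ → σ → R, Q = ∑ i, ∑ j, C (c i j) * (X i * X j)) ?_ ?_ ?_
  · rintro _ _ ⟨a, rfl⟩ ⟨b, rfl⟩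
    exact ⟨a + b, by simp [add_mul, Finset.sum_add_distrib]⟩
  · exact ⟨0, by simp⟩
  · intro d hd
    have hdeg : Multiset.card (Finsupp.toMultiset d) = 2 := by
      rw [Finsupp.card_toMultiset]
      have : d.degree = 2 := by
        rw [Finsupp.degree_eq_weight_one]
        exact hP (mem_support_iff.mp hd)
      exact this
    obtain ⟨i, j, hij⟩ := Multiset.card_eq_two.mp hdeg
    have hd' : d = Finsupp.single i 1 + Finsupp.single j 1 := by
      rw [← Finsupp.toMultiset_toFinsupp d, hij]
      change Multiset.toFinsupp ({i} + {j}) = _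
      rw [map_add, Multiset.toFinsupp_singleton, Multiset.toFinsupp_singleton]
    refine ⟨fun k l => if k = i then if l = j then coeff d P else 0 else 0, ?_⟩
    rw [Finset.sum_eq_single i (by intro k _ hk; simp [hk]) (by simp),
      Finset.sum_eq_single j (by intro k _ hk; simp [hk]) (by simp)]
    simp only [if_true, X, C_mul_monomial, monomial_mul, mul_one, ← hd']

/-- Expansion of a ternary quadratic form along three vectors. -/
theorem MvPolynomial.IsHomogeneous.eval_smul_add_smul_add_smul {R : Type*} [CommRing R]
    {P : MvPolynomial (Fin 3) R} (hP : P.IsHomogeneous 2) (p u v : Fin 3 → R) (x y z : R) :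
    eval (x • p + y • u + z • v) P =
      x ^ 2 * eval p P + y ^ 2 * eval u P + z ^ 2 * eval v P
        + x * y * ∑ j, eval p (pderiv j P) * u j
        + x * z * ∑ j, eval p (pderiv j P) * v j
        + y * z * ∑ j, eval u (pderiv j P) * v j := by
  obtain ⟨c, rfl⟩ := hP.exists_eq_sum_C_mul_X_mul_X
  simp [Fin.sum_univ_three, pderiv_X, Pi.single_apply]
  ring

/-- Euler's identity for a ternary quadratic form. -/
theorem MvPolynomial.IsHomogeneous.sum_eval_pderiv_mul_self {R : Type*} [CommRing R]
    {P : MvPolynomial (Fin 3) R} (hP : P.IsHomogeneous 2) (p : Fin 3 → R) :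
    ∑ j, eval p (pderiv j P) * p j = 2 * eval p P := by
  obtain ⟨c, rfl⟩ := hP.exists_eq_sum_C_mul_X_mul_X
  simp [Fin.sum_univ_three, pderiv_X, Pi.single_apply]
  ring

/-- A hyperplane of dimension at least two is not contained in a line. -/
theorem exists_dotProduct_eq_zero_and_notMem_span {K : Type*} [Field K] (g p : Fin 3 → K) :
    ∃ u : Fin 3 → K, g ⬝ᵥ u = 0 ∧ u ∉ Submodule.span K {p} := by
  let l : (Fin 3 → K) →ₗ[K] K := dotProductBilin K K g
  by_contra! h
  have hle : LinearMap.ker l ≤ Submodule.span K {p} := fun u hu => h u hu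
  have hker := (Submodule.finrank_mono hle).trans (finrank_span_le_card ({p} : Set (Fin 3 → K)))
  have hrange := (LinearMap.range l).finrank_le
  have hrank := l.finrank_range_add_finrank_ker
  simp at hker hrange hrank
  omega

/-- Over an algebraically closed field, a polynomial function of degree at most two without zeros
is constant. -/
theorem IsAlgClosed.exists_forall_quadratic_eq {K : Type*} [Field K] [IsAlgClosed K] (a b c : K)
    (h : ∀ t : K, a * t ^ 2 + b * t + c ≠ 0) : ∃ k : K, ∀ t : K, a * t ^ 2 + b * t + c = k := by
  let D : Polynomial K := .C a * .X ^ 2 + .C b * .X + .C c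
  have hD (t : K) : D.eval t = a * t ^ 2 + b * t + c := by simp [D]
  have hdeg : D.degree = 0 := by
    by_contra hne
    obtain ⟨t, ht⟩ := IsAlgClosed.exists_root D hne
    exact h t (by rw [← hD]; exact ht)
  refine ⟨D.coeff 0, fun t => ?_⟩
  rw [← hD, Polynomial.eq_C_of_degree_eq_zero hdeg]
  simp

/-- Lemma 6(ii), two tangentially intersecting conics: the complement in `P²(K)`
of two nonsingular conics meeting tangentially in exactly one point is not
`K`-hyperbolic. -/
theorem two_tangent_conics_not_hyperbolic
    {K : Type*} [NontriviallyNormedField K] [CompleteSpace K] [IsAlgClosed K]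
    [IsUltrametricDist K]
    (P₁ P₂ : MvPolynomial (Fin 3) K)
    (hP₁ : P₁.IsHomogeneous 2) (hP₂ : P₂.IsHomogeneous 2)
    (hns₁ : ∀ a : Fin 3 → K, a ≠ 0 → eval a P₁ = 0 →
      ∃ j, eval a (pderiv j P₁) ≠ 0)
    (hns₂ : ∀ a : Fin 3 → K, a ≠ 0 → eval a P₂ = 0 →
      ∃ j, eval a (pderiv j P₂) ≠ 0)
    (p : Fin 3 → K) (hp : p ≠ 0)
    (hp₁ : eval p P₁ = 0) (hp₂ : eval p P₂ = 0)
    (hunique : ∀ a : Fin 3 → K, a ≠ 0 → eval a P₁ = 0 → eval a P₂ = 0 →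
      ∃ s : K, a = s • p)
    (htangent : ∃ c : K, c ≠ 0 ∧
      (fun j : Fin 3 => eval p (pderiv j P₂)) = c • fun j : Fin 3 => eval p (pderiv j P₁)) :
    ∃ f : Fin 3 → K → K,
      (∀ i, ∀ z : K, AnalyticAt K (f i) z) ∧
      (∀ z : K, ∃ i, f i z ≠ 0) ∧
      (∀ z : K, eval (fun i => f i z) P₁ ≠ 0) ∧
      (∀ z : K, eval (fun i => f i z) P₂ ≠ 0) ∧
      ¬ (∀ z w : K, ∃ c : K, c ≠ 0 ∧ ∀ i, f i z = c * f i w) := by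
  obtain ⟨c, hc, htan⟩ := htangent
  obtain ⟨j, hj⟩ := hns₁ p hp hp₁
  let g : Fin 3 → K := fun j => eval p (pderiv j P₁)
  have hg (w : Fin 3 → K) : ∑ j, eval p (pderiv j P₁) * w j = g ⬝ᵥ w := rfl
  have hg₂ (w : Fin 3 → K) : ∑ j, eval p (pderiv j P₂) * w j = c * g ⬝ᵥ w := by
    rw [← smul_eq_mul, ← smul_dotProduct, ← htan]
    rfl
  have hgp : g ⬝ᵥ p = 0 := by rw [← hg, hP₁.sum_eval_pderiv_mul_self, hp₁, mul_zero]
  obtain ⟨u, hgu, hu⟩ := exists_dotProduct_eq_zero_and_notMem_span g p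
  obtain ⟨v, hgv⟩ : ∃ v : Fin 3 → K, g ⬝ᵥ v = 1 :=
    ⟨Pi.single j (g j)⁻¹, by rw [dotProduct_single]; exact mul_inv_cancel₀ hj⟩
  have hQ₁ (x t : K) : eval (x • p + t • u + v) P₁ =
      x + (eval u P₁ * t ^ 2 + (∑ j, eval u (pderiv j P₁) * v j) * t + eval v P₁) := by
    have := hP₁.eval_smul_add_smul_add_smul p u v x t 1
    rw [one_smul, hg, hg, hgu, hgv, hp₁] at this
    rw [this]
    ring
  have hQ₂ (x t : K) : eval (x • p + t • u + v) P₂ =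
      c * x + (eval u P₂ * t ^ 2 + (∑ j, eval u (pderiv j P₂) * v j) * t + eval v P₂) := by
    have := hP₂.eval_smul_add_smul_add_smul p u v x t 1
    rw [one_smul, hg₂, hg₂, hgu, hgv, hp₂] at this
    rw [this]
    ring
  set b₁ := ∑ j, eval u (pderiv j P₁) * v j
  set b₂ := ∑ j, eval u (pderiv j P₂) * v j
  let q : K → K := fun t => eval u P₁ * t ^ 2 + b₁ * t + eval v P₁
  have hgF (x t : K) : g ⬝ᵥ (x • p + t • u + v) = 1 := by
    simp [dotProduct_add, dotProduct_smul, hgp, hgu, hgv]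
  have hF (x t : K) : x • p + t • u + v ≠ 0 := fun h => by
    simpa [h] using hgF x t
  obtain ⟨k, hk⟩ := IsAlgClosed.exists_forall_quadratic_eq (eval u P₂ - c * eval u P₁)
    (b₂ - c * b₁) (eval v P₂ - c * eval v P₁) fun t ht => by
      obtain ⟨r, hr⟩ := hunique (-q t • p + t • u + v) (hF _ _)
        (by rw [hQ₁]; simp only [q]; ring) (by rw [hQ₂, ← ht]; simp only [q]; ring)
      have := hgF (-q t) t
      rw [hr, dotProduct_smul, hgp, smul_zero] at this
      exact zero_ne_one this
  obtain ⟨s, hs⟩ := (Set.toFinite {0, -k / c}).exists_notMem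
  simp only [Set.mem_insert_iff, Set.mem_singleton_iff, not_or] at hs
  let F : K → Fin 3 → K := fun t => (s - q t) • p + t • u + v
  refine ⟨fun i t => F t i, fun i z => ?_, fun z => Function.ne_iff.mp (hF _ _),
    fun z => ?_, fun z => ?_, fun h => ?_⟩
  · simp only [F, q, Pi.add_apply, Pi.smul_apply, smul_eq_mul]
    fun_prop
  · change eval (F z) P₁ ≠ 0
    rw [hQ₁, show s - q z + _ = s by simp only [q]; ring]
    exact hs.1
  · change eval (F z) P₂ ≠ 0
    have : eval (F z) P₂ = c * s + k := by
      rw [hQ₂, ← hk z]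
      simp only [q]
      ring
    rw [this]
    intro h0
    apply hs.2
    rw [eq_div_iff hc]
    linear_combination h0
  · obtain ⟨r, -, hr⟩ := h 1 0
    have hr : F 1 = r • F 0 := funext hr
    have hr1 : (1 : K) = r := by
      have := congrArg (g ⬝ᵥ ·) hr
      simpa only [F, dotProduct_smul, hgF, smul_eq_mul, mul_one] using this
    refine hu (Submodule.mem_span_singleton.mpr ⟨q 1 - q 0, ?_⟩)
    rw [← hr1, one_smul] at hr
    ext i
    have := congrFun hr i
    simp only [F, Pi.add_apply, Pi.smul_apply, smul_eq_mul] at this ⊢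
    linear_combination -this
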